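/- Let G be a conjugacy separable group and let x, y ∈ G. Suppose that for every n ≥ 1 and every group homomorphism ρ : G → GL_n(ℂ), the traces tr(ρ(x)) and tr(ρ(y)) are equal. Then x and y are conjugate in G. -/

import Mathlib

/-- A group `G` is *conjugacy separable* if any two non-conjugate elements of
`G` remain non-conjugate in some finite quotient: for all `x y : G` not
conjugate in `G`, there are a finite group `H` and a homomorphism `p : G →* H`
such that `p x` and `p y` are not conjugate in `H`. -/
def ConjugacySeparable (G : Type*) [Group G] : Prop :=
  ∀ x y : G, ¬ IsConj x y →
    ∃ (H : Type) (_ : Group H) (_ : Finite H) (p : G →* H), ¬ IsConj (p x) (p y)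

theorem finite_isConj_aux {H : Type} [Group H] [Finite H] (a b : H)
    (h : ∀ n : ℕ, 1 ≤ n → ∀ ρ : H →* Matrix.GeneralLinearGroup (Fin n) ℂ,
      Matrix.trace (↑(ρ a) : Matrix (Fin n) (Fin n) ℂ) =
        Matrix.trace (↑(ρ b) : Matrix (Fin n) (Fin n) ℂ)) :
    IsConj a b := by
  classical
  have := Fintype.ofFinite H
  have : NeZero (Nat.card H : ℂ) := ⟨by exact_mod_cast Nat.card_pos.ne'⟩
  have : FiniteDimensional ℂ (MonoidAlgebra ℂ H) :=
    Module.Finite.equiv (MonoidAlgebra.coeffLinearEquiv ℂ (S := ℂ) (M := H)).symm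
  obtain ⟨n, d, hd, ⟨e⟩⟩ :=
    IsSemisimpleRing.exists_algEquiv_pi_matrix_of_isAlgClosed ℂ (MonoidAlgebra ℂ H)
  let o : H →* MonoidAlgebra ℂ H := MonoidAlgebra.of ℂ H
  let S : H → MonoidAlgebra ℂ H := fun c => ∑ g : H, o (g * c * g⁻¹)
  have hS : ∀ c k, o k * S c = S c * o k := by
    intro c k
    simp only [S, Finset.mul_sum, Finset.sum_mul, ← map_mul]
    refine Fintype.sum_equiv (Equiv.mulLeft k) _ _ fun g => ?_
    congr 1
    simp [mul_assoc]
  have hz : ∀ w, w * (S a - S b) = (S a - S b) * w := by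
    intro w
    induction w using MonoidAlgebra.induction_on with
    | of k =>
      change o k * _ = _ * o k
      rw [mul_sub, sub_mul, hS, hS]
    | add f g hf hg => rw [add_mul, mul_add, hf, hg]
    | smul r f hf => rw [smul_mul_assoc, mul_smul_comm, hf]
  have h0 : S a - S b = 0 := by
    apply e.injective
    rw [map_zero]
    funext i
    let π : MonoidAlgebra ℂ H →ₐ[ℂ] Matrix (Fin (d i)) (Fin (d i)) ℂ :=
      (Pi.evalAlgHom ℂ (fun i => Matrix (Fin (d i)) (Fin (d i)) ℂ) i).comp e.toAlgHom
    have hπ : Function.Surjective π := fun m =>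
      ⟨e.symm (Pi.single i m), by simp [π]⟩
    change π (S a - S b) = 0
    have htr : Matrix.trace (π (o a)) = Matrix.trace (π (o b)) :=
      h (d i) (Nat.one_le_iff_ne_zero.2 (hd i).ne)
        (((MonoidHomClass.toMonoidHom π).comp o).toHomUnits)
    have hc : ∀ c, Matrix.trace (π (S c)) = Fintype.card H * Matrix.trace (π (o c)) := by
      intro c
      simp only [S, map_sum, Matrix.trace_sum]
      rw [Finset.sum_congr rfl (g := fun _ => Matrix.trace (π (o c)))]
      · simp
      · intro g _
        rw [map_mul, map_mul, Matrix.trace_mul_comm, ← map_mul, ← map_mul]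
        simp
    have ht : Matrix.trace (π (S a - S b)) = 0 := by
      rw [map_sub, Matrix.trace_sub, hc, hc, htr, sub_self]
    obtain ⟨r, hr⟩ := Matrix.mem_range_scalar_of_commute_single (M := π (S a - S b)) (by
      intro p q _
      obtain ⟨w, hw⟩ := hπ (Matrix.single p q 1)
      rw [← hw]
      change _ * _ = _ * _
      rw [← map_mul, ← map_mul, hz])
    rw [← hr] at ht ⊢
    have : (d i : ℂ) ≠ 0 := by exact_mod_cast (hd i).ne
    have hr0 : r = 0 := by
      simpa [Matrix.trace, this] using ht
    simp [hr0]
  by_contra hab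
  have h1 := congrArg (fun w => MonoidAlgebra.coeff w a) (sub_eq_zero.1 h0)
  have key : ∀ c, (S c).coeff a = ((Finset.univ.filter fun g : H => g * c * g⁻¹ = a).card : ℂ) := by
    intro c
    simp [S, o, MonoidAlgebra.of_apply, Finsupp.single_apply]
  simp only [key] at h1
  have h2 : (Finset.univ.filter fun g : H => g * b * g⁻¹ = a) = ∅ := by
    refine Finset.filter_eq_empty_iff.2 fun g _ hg => hab ?_
    exact (isConj_iff.2 ⟨g, hg⟩).symm
  rw [h2, Finset.card_empty, Nat.cast_inj, Finset.card_eq_zero] at h1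
  have : (1 : H) ∈ (Finset.univ.filter fun g : H => g * a * g⁻¹ = a) := by simp
  rw [h1] at this
  simp at this

/-- If `G` is conjugacy separable and `x, y ∈ G` have equal traces under every
finite-dimensional complex representation `ρ : G →* GL_n(ℂ)` (for every `n ≥ 1`),
then `x` and `y` are conjugate in `G`. -/
theorem isConj_of_trace_eq {G : Type*} [Group G] (hG : ConjugacySeparable G)
    (x y : G)
    (h : ∀ n : ℕ, 1 ≤ n → ∀ ρ : G →* Matrix.GeneralLinearGroup (Fin n) ℂ,
      Matrix.trace (↑(ρ x) : Matrix (Fin n) (Fin n) ℂ) =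
        Matrix.trace (↑(ρ y) : Matrix (Fin n) (Fin n) ℂ)) :
    IsConj x y := by
  by_contra hxy
  obtain ⟨H, _, _, p, hp⟩ := hG x y hxy
  exact hp (finite_isConj_aux _ _ fun n hn ρ => h n hn (ρ.comp p))
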